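/- Let m be a universal semimeasure with a fixed approximation (m_t) from below. Define Ω_t = ∑_{|x| ≤ t} m_t(x), and for t ≥ 1 with Ω_t ≠ Ω_{t−1}, let k_t be the position of the leftmost binary digit in which Ω_t differs from Ω_{t−1}, i.e. the least natural number k with ⌊2^k · Ω_t⌋ ≠ ⌊2^k · Ω_{t−1}⌋. Then there exists a computable function f : ℕ → ℕ such that for all sufficiently large t with Ω_t ≠ Ω_{t−1}: m_{f(t)}(t) ≥ 2^{−k_t}/k_t², where m_s(t) denotes m_s evaluated at the string of t zeros. -/

import Mathlib

open scoped ENNReal NNReal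

/-- Interpret a rational approximation value as an extended nonnegative real. -/
noncomputable def qval (q : ℚ) : ℝ≥0∞ := ENNReal.ofReal q

/-- Interpret a value in `ℚ≥0 ∪ {∞}` (with nonnegativity required separately)
as an extended nonnegative real; `none` stands for `∞`. -/
noncomputable def qtval (q : Option ℚ) : ℝ≥0∞ := q.elim ⊤ (fun a => ENNReal.ofReal a)

/-- A (discrete) semimeasure on bitstrings. -/
def IsSemimeasure (P : List Bool → ℝ≥0∞) : Prop := ∑' x, P x ≤ 1

/-- `Ps` is a computable approximation of `P` from below (by nonnegative rationals,
nondecreasing in the stage). -/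
def IsApproxFromBelow (P : List Bool → ℝ≥0∞) (Ps : List Bool → ℕ → ℚ) : Prop :=
  Computable (fun p : List Bool × ℕ => Ps p.1 p.2) ∧
  (∀ x s, 0 ≤ Ps x s) ∧
  (∀ x, Monotone fun s => Ps x s) ∧
  (∀ x, P x = ⨆ s, qval (Ps x s))

/-- `P` is lower semicomputable. -/
def LowerSemicomputable (P : List Bool → ℝ≥0∞) : Prop := ∃ Ps, IsApproxFromBelow P Ps

/-- `es` is a computable approximation of `e` from above (by values in `ℚ≥0 ∪ {∞}`,
nonincreasing in the stage). -/
def IsApproxFromAbove (e : List Bool → ℝ≥0∞) (es : List Bool → ℕ → Option ℚ) : Prop :=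
  Computable (fun p : List Bool × ℕ => es p.1 p.2) ∧
  (∀ x s, ∀ a ∈ es x s, (0:ℚ) ≤ a) ∧
  (∀ x, Antitone fun s => qtval (es x s)) ∧
  (∀ x, e x = ⨅ s, qtval (es x s))

/-- `e` is upper semicomputable. -/
def UpperSemicomputable (e : List Bool → ℝ≥0∞) : Prop := ∃ es, IsApproxFromAbove e es

/-- `e` is a sumtest for the semimeasure `P`. -/
def IsSumtest (P e : List Bool → ℝ≥0∞) : Prop := ∑' x, P x * e x ≤ 1

/-- `m` is a universal (lower semicomputable) semimeasure. -/
def IsUniversalSemimeasure (m : List Bool → ℝ≥0∞) : Prop :=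
  IsSemimeasure m ∧ LowerSemicomputable m ∧
  ∀ P, IsSemimeasure P → LowerSemicomputable P → ∃ c : ℝ≥0, 0 < c ∧ ∀ x, P x ≤ c * m x

/-- A conditional semimeasure `m(·|·)`. -/
def IsCondSemimeasure (m : List Bool → ℕ → ℝ≥0∞) : Prop := ∀ s, ∑' x, m x s ≤ 1

/-- `ms` is a computable approximation from below of the conditional semimeasure `m`:
`ms t x s` approximates `m(x|s)`, nondecreasing in the stage `t`. -/
def IsCondApproxFromBelow (m : List Bool → ℕ → ℝ≥0∞) (ms : ℕ → List Bool → ℕ → ℚ) : Prop :=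
  Computable (fun p : ℕ × List Bool × ℕ => ms p.1 p.2.1 p.2.2) ∧
  (∀ t x s, 0 ≤ ms t x s) ∧
  (∀ x s, Monotone fun t => ms t x s) ∧
  (∀ x s, m x s = ⨆ t, qval (ms t x s))

/-- The conditional semimeasure `m` is lower semicomputable (jointly). -/
def CondLowerSemicomputable (m : List Bool → ℕ → ℝ≥0∞) : Prop :=
  ∃ ms, IsCondApproxFromBelow m ms

/-- `m(·|·)` is a universal lower semicomputable conditional semimeasure. -/
def IsUniversalCondSemimeasure (m : List Bool → ℕ → ℝ≥0∞) : Prop :=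
  IsCondSemimeasure m ∧ CondLowerSemicomputable m ∧
  ∀ m', IsCondSemimeasure m' → CondLowerSemicomputable m' →
    ∃ c : ℝ≥0, 0 < c ∧ ∀ x s, m' x s ≤ c * m x s

/-- The string consisting of `t` zeros, representing the natural number `t`. -/
def zeros (t : ℕ) : List Bool := List.replicate t false

/-- `Ω_t = ∑_{|x| ≤ t} m_t(x)`, as a real number. -/
noncomputable def Omega (mt : List Bool → ℕ → ℚ) (t : ℕ) : ℝ :=
  ∑' x : List Bool, if x.length ≤ t then ((mt x t : ℝ)) else 0

/-- Unbounded search for a total computable predicate is computable. -/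
theorem Computable.natFind {α : Type*} [Primcodable α] {p : α → ℕ → Bool}
    (hp : Computable₂ p) (h : ∀ a, ∃ n, p a n = true) :
    Computable fun a => Nat.find (h a) := by
  refine (Partrec.rfind (p := fun a n => Part.some (p a n)) hp.partrec₂).of_eq_tot fun a => ?_
  refine Nat.mem_rfind.2 ⟨?_, fun {k} hk => ?_⟩
  · simpa using (Nat.find_spec (h a)).symm
  · simpa using Nat.find_min (h a) hk

/-- The code of a rational as a pair of a numerator and a denominator; the encoding used by the
`Denumerable ℚ` instance lists the rationals by increasing value of this code. -/
def ratCode (q : ℚ) : ℕ := @Encodable.encode ℚ Rat.instEncodable q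

theorem ratCode_eq (q : ℚ) : ratCode q = Nat.pair (Encodable.encode q.num) q.den := rfl

theorem ratCode_injective : Function.Injective ratCode :=
  @Encodable.encode_injective ℚ Rat.instEncodable

theorem encode_int_add_one_div_two (z : ℤ) : (Encodable.encode z + 1) / 2 = z.natAbs := by
  rcases z with n | n
  · change (2 * n + 1) / 2 = n
    omega
  · change (2 * n + 1 + 1) / 2 = n + 1
    omega

theorem mem_range_ratCode_iff (c : ℕ) :
    c ∈ Set.range ratCode ↔
      0 < c.unpair.2 ∧ ((c.unpair.1 + 1) / 2).Coprime c.unpair.2 := by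
  constructor
  · rintro ⟨q, rfl⟩
    rw [ratCode_eq, Nat.unpair_pair]
    exact ⟨q.den_pos, by simpa only [encode_int_add_one_div_two] using q.reduced⟩
  · rintro ⟨hpos, hco⟩
    obtain ⟨z, hz⟩ : ∃ z : ℤ, Encodable.encode z = c.unpair.1 :=
      ⟨Denumerable.ofNat ℤ c.unpair.1, Denumerable.encode_ofNat _⟩
    rw [← hz, encode_int_add_one_div_two] at hco
    refine ⟨⟨z, c.unpair.2, hpos.ne', hco⟩, ?_⟩
    rw [ratCode_eq]
    change Nat.pair (Encodable.encode z) c.unpair.2 = c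
    rw [hz, Nat.pair_unpair]

theorem Nat.coprime_iff_forall_lt (a b : ℕ) :
    a.Coprime b ↔ ∀ d < a + b + 1, ¬ (a % d = 0 ∧ b % d = 0 ∧ d ≠ 1) := by
  constructor
  · rintro h d - ⟨ha, hb, hd⟩
    exact hd (Nat.eq_one_of_dvd_coprimes h (Nat.dvd_of_mod_eq_zero ha)
      (Nat.dvd_of_mod_eq_zero hb))
  · intro h
    by_contra hne
    refine h (a.gcd b) ?_ ⟨Nat.mod_eq_zero_of_dvd (Nat.gcd_dvd_left a b),
      Nat.mod_eq_zero_of_dvd (Nat.gcd_dvd_right a b), hne⟩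
    rcases Nat.eq_zero_or_pos a with rfl | ha
    · simp
    · have := Nat.gcd_le_left b ha
      omega

theorem primrecPred_mem_range_ratCode : PrimrecPred fun c : ℕ => c ∈ Set.range ratCode := by
  have hunp1 : Primrec fun c : ℕ => c.unpair.1 := Primrec.fst.comp Primrec.unpair
  have hunp2 : Primrec fun c : ℕ => c.unpair.2 := Primrec.snd.comp Primrec.unpair
  have hco : PrimrecRel fun (d : ℕ) (c : ℕ × ℕ) => ¬ (c.1 % d = 0 ∧ c.2 % d = 0 ∧ d ≠ 1) := by
    refine PrimrecPred.not (PrimrecPred.and ?_ (PrimrecPred.and ?_ (PrimrecPred.not ?_)))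
    · exact Primrec.eq.comp (Primrec.nat_mod.comp (Primrec.fst.comp Primrec.snd) Primrec.fst)
        (Primrec.const 0)
    · exact Primrec.eq.comp (Primrec.nat_mod.comp (Primrec.snd.comp Primrec.snd) Primrec.fst)
        (Primrec.const 0)
    · exact Primrec.eq.comp Primrec.fst (Primrec.const 1)
  have hnum : Primrec fun c : ℕ => (c.unpair.1 + 1) / 2 :=
    Primrec.nat_div.comp (Primrec.succ.comp hunp1) (Primrec.const 2)
  have hall := (PrimrecRel.forall_mem_list hco).comp
    (Primrec.list_range.comp (Primrec.succ.comp (Primrec.nat_add.comp hnum hunp2))) (hnum.pair hunp2)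
  refine (PrimrecPred.and (Primrec.nat_lt.comp (Primrec.const 0) hunp2) hall).of_eq fun c => ?_
  simp only [mem_range_ratCode_iff, Nat.coprime_iff_forall_lt, List.mem_range]

instance : Infinite (Set.range ratCode) :=
  Infinite.of_injective _ (Equiv.ofInjective _ ratCode_injective).injective

theorem ratCode_ofNat [DecidablePred (· ∈ Set.range ratCode)] (n : ℕ) :
    ratCode (Denumerable.ofNat ℚ n) = (Nat.Subtype.ofNat (Set.range ratCode) n : ℕ) := by
  have hdec : ‹DecidablePred (· ∈ Set.range ratCode)› =
    @Encodable.decidableRangeEncode ℚ Rat.instEncodable := Subsingleton.elim _ _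
  subst hdec
  exact congrArg Subtype.val
    ((@Encodable.equivRangeEncode ℚ Rat.instEncodable).apply_symm_apply _)

theorem computable_ratCode : Computable ratCode := by
  obtain ⟨hdec, hR⟩ := primrecPred_mem_range_ratCode
  have hp : Computable₂ fun c m : ℕ => decide (c + m + 1 ∈ Set.range ratCode) :=
    (hR.comp (Primrec.succ.comp (Primrec.nat_add.comp Primrec.fst Primrec.snd))).to_comp
  have hex : ∀ c : ℕ, ∃ m, decide (c + m + 1 ∈ Set.range ratCode) = true := by
    intro c
    obtain ⟨b, hb, hcb⟩ := (Set.infinite_coe_iff.1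
      (inferInstance : Infinite (Set.range ratCode))).exists_gt c
    exact ⟨b - c - 1, by rw [decide_eq_true_iff]; convert hb using 1; omega⟩
  have hfind := Computable.natFind hp hex
  have hstep : Computable fun c : ℕ => c + Nat.find (hex c) + 1 :=
    Computable.succ.comp (Primrec.nat_add.to_comp.comp Computable.id hfind)
  have hrec : Computable fun n : ℕ => (Nat.Subtype.ofNat (Set.range ratCode) n : ℕ) := by
    refine (Computable.nat_rec (f := fun n : ℕ => n)
      (g := fun _ => ((⊥ : Set.range ratCode) : ℕ))
      (h := fun _ p => p.2 + Nat.find (hex p.2) + 1) Computable.id (Computable.const _)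
      (hstep.comp (Computable.snd.comp Computable.snd))).of_eq fun n => ?_
    induction n with
    | zero => rfl
    | succ n ih =>
      simp only [Nat.Subtype.ofNat, Nat.Subtype.succ] at ih ⊢
      rw [ih]
      simp only [decide_eq_true_eq]
  refine (hrec.comp (Computable.encode (α := ℚ))).of_eq fun q => ?_
  rw [← ratCode_ofNat, Denumerable.ofNat_encode]

/-- The numerator of a nonnegative rational, as a natural number. -/
def ratNum (q : ℚ) : ℕ := (ratCode q).unpair.1 / 2

theorem ratNum_eq {q : ℚ} (hq : 0 ≤ q) : (ratNum q : ℤ) = q.num := by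
  rw [ratNum, ratCode_eq, Nat.unpair_pair]
  obtain ⟨n, hn⟩ := Int.eq_ofNat_of_zero_le (Rat.num_nonneg.2 hq)
  rw [hn]
  change ((2 * n / 2 : ℕ) : ℤ) = n
  omega

theorem computable_ratNum : Computable ratNum :=
  Primrec.nat_div.to_comp.comp (Computable.fst.comp (Computable.unpair.comp computable_ratCode))
    (Computable.const 2)

theorem computable_ratDen : Computable Rat.den :=
  (Computable.snd.comp (Computable.unpair.comp computable_ratCode)).of_eq fun q => by
    rw [ratCode_eq, Nat.unpair_pair]

theorem ratNum_div_den {q : ℚ} (hq : 0 ≤ q) : (ratNum q : ℚ) / q.den = q := by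
  rw [← Int.cast_natCast, ratNum_eq hq, Rat.num_div_den]

theorem computable_natCast_inv : Computable fun n : ℕ => ((n : ℚ))⁻¹ := by
  have hcode : ∀ n : ℕ, ratCode ((n : ℚ)⁻¹) =
      Nat.pair (if n = 0 then 0 else 2) (if n = 0 then 1 else n) := by
    intro n
    rw [ratCode_eq]
    rcases Nat.eq_zero_or_pos n with rfl | hn
    · simp
      rfl
    · rw [Rat.inv_natCast_num_of_pos hn, Rat.inv_natCast_den_of_pos hn, if_neg hn.ne',
        if_neg hn.ne']
      rfl
  have hprim : Primrec fun n : ℕ =>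
      Nat.pair (if n = 0 then 0 else 2) (if n = 0 then 1 else n) :=
    Primrec₂.natPair.comp
      (Primrec.ite (Primrec.eq.comp Primrec.id (Primrec.const 0)) (Primrec.const 0)
        (Primrec.const 2))
      (Primrec.ite (Primrec.eq.comp Primrec.id (Primrec.const 0)) (Primrec.const 1) Primrec.id)
  have hp : Computable₂ fun n k : ℕ => decide (ratCode (Denumerable.ofNat ℚ k) =
      Nat.pair (if n = 0 then 0 else 2) (if n = 0 then 1 else n)) :=
    Primrec.eq.decide.to_comp.comp
      (computable_ratCode.comp ((Computable.ofNat ℚ).comp Computable.snd))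
      (hprim.to_comp.comp Computable.fst)
  have hex : ∀ n : ℕ, ∃ k, decide (ratCode (Denumerable.ofNat ℚ k) =
      Nat.pair (if n = 0 then 0 else 2) (if n = 0 then 1 else n)) = true := fun n =>
    ⟨@Encodable.encode ℚ Rat.instDenumerable.toEncodable (n : ℚ)⁻¹, by rw [decide_eq_true_iff, Denumerable.ofNat_encode, hcode]⟩
  refine ((Computable.ofNat ℚ).comp (Computable.natFind hp hex)).of_eq fun n => ?_
  have := Nat.find_spec (hex n)
  exact ratCode_injective ((decide_eq_true_iff.1 this).trans (hcode n).symm)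

/-- The list of all bitstrings of length at most `n`. -/
def stringsUpTo : ℕ → List (List Bool)
  | 0 => [[]]
  | n + 1 => [] :: ((stringsUpTo n).map (List.cons false) ++ (stringsUpTo n).map (List.cons true))

theorem mem_stringsUpTo {n : ℕ} {x : List Bool} : x ∈ stringsUpTo n ↔ x.length ≤ n := by
  induction n generalizing x with
  | zero => simp [stringsUpTo]
  | succ n ih =>
    rcases x with _ | ⟨b, x⟩
    · simp [stringsUpTo]
    · cases b <;> simp [stringsUpTo, ih]

theorem nodup_stringsUpTo (n : ℕ) : (stringsUpTo n).Nodup := by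
  induction n with
  | zero => simp [stringsUpTo]
  | succ n ih =>
    refine List.nodup_cons.2 ⟨by simp, List.Nodup.append ?_ ?_ ?_⟩
    · exact ih.map (List.cons_injective)
    · exact ih.map (List.cons_injective)
    · intro x hx hy
      simp only [List.mem_map] at hx hy
      obtain ⟨a, -, rfl⟩ := hx
      obtain ⟨b, -, hb⟩ := hy
      simp at hb

theorem primrec_stringsUpTo : Primrec stringsUpTo := by
  refine (Primrec.nat_rec₁ (f := fun _ l =>
    [] :: (l.map (List.cons false) ++ l.map (List.cons true))) [[]] ?_).of_eq fun n => ?_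
  · refine Primrec.list_cons.comp (Primrec.const []) (Primrec.list_append.comp ?_ ?_)
    · exact Primrec.list_map Primrec.snd (Primrec.list_cons.comp (Primrec.const false) Primrec.snd)
    · exact Primrec.list_map Primrec.snd (Primrec.list_cons.comp (Primrec.const true) Primrec.snd)
  · induction n with
    | zero => rfl
    | succ n ih => simp only [stringsUpTo, ← ih]

/-- The value of `F` at stage `t` on the `j`-th bitstring of length at most `t`. -/
def stageValue (F : List Bool → ℕ → ℚ) (t j : ℕ) : ℚ :=
  F (((stringsUpTo t)[j]?).getD []) t

theorem computable_stageValue {F : List Bool → ℕ → ℚ}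
    (hF : Computable fun p : List Bool × ℕ => F p.1 p.2) : Computable₂ (stageValue F) := by
  have hL : Computable fun a : ℕ × ℕ => stringsUpTo a.1 :=
    primrec_stringsUpTo.to_comp.comp Computable.fst
  have ho : Computable fun a : ℕ × ℕ => (stringsUpTo a.1)[a.2]? :=
    Computable.list_getElem?.comp hL Computable.snd
  have hx : Computable fun a : ℕ × ℕ => ((stringsUpTo a.1)[a.2]?).getD [] :=
    Computable.option_getD ho (Computable.const [])
  have hpair : Computable fun a : ℕ × ℕ => (((stringsUpTo a.1)[a.2]?).getD [], a.1) :=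
    hx.pair Computable.fst
  exact (hF.comp hpair).of_eq fun _ => rfl

/-- Add a nonnegative rational to a pair of a numerator and a denominator. -/
def addFraction (q : ℚ) (p : ℕ × ℕ) : ℕ × ℕ :=
  (p.1 * q.den + ratNum q * p.2, p.2 * q.den)

theorem computable_addFraction : Computable₂ addFraction := by
  have hn : Computable fun a : ℚ × ℕ × ℕ => ratNum a.1 := computable_ratNum.comp Computable.fst
  have hd : Computable fun a : ℚ × ℕ × ℕ => a.1.den := computable_ratDen.comp Computable.fst
  have hp1 : Computable fun a : ℚ × ℕ × ℕ => a.2.1 := Computable.fst.comp Computable.snd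
  have hp2 : Computable fun a : ℚ × ℕ × ℕ => a.2.2 := Computable.snd.comp Computable.snd
  exact (Primrec.nat_add.to_comp.comp (Primrec.nat_mul.to_comp.comp hp1 hd)
    (Primrec.nat_mul.to_comp.comp hn hp2)).pair (Primrec.nat_mul.to_comp.comp hp2 hd)

/-- The sum of `F` at stage `t` over the first `i` bitstrings of length at most `t`, as a pair of a
numerator and a denominator. -/
def partialFraction (F : List Bool → ℕ → ℚ) (t : ℕ) (i : ℕ) : ℕ × ℕ :=
  Nat.rec (0, 1) (fun j p => addFraction (stageValue F t j) p) i

/-- The value `Ω_t`, as a pair of a numerator and a denominator. -/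
def omegaFraction (F : List Bool → ℕ → ℚ) (t : ℕ) : ℕ × ℕ :=
  partialFraction F t (stringsUpTo t).length

theorem partialFraction_spec {F : List Bool → ℕ → ℚ} (hF : ∀ x s, 0 ≤ F x s) (t i : ℕ)
    (hi : i ≤ (stringsUpTo t).length) :
    0 < (partialFraction F t i).2 ∧
      ((partialFraction F t i).1 : ℝ) / (partialFraction F t i).2 =
        (((stringsUpTo t).take i).map fun x => (F x t : ℝ)).sum := by
  induction i with
  | zero => simp [partialFraction]
  | succ i ih =>
    obtain ⟨hpos, heq⟩ := ih (by omega)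
    have hget : (stringsUpTo t)[i]? = some (stringsUpTo t)[i] := List.getElem?_eq_getElem (by omega)
    set q := F (stringsUpTo t)[i] t with hq
    have hstep : partialFraction F t (i + 1) =
        ((partialFraction F t i).1 * q.den + ratNum q * (partialFraction F t i).2,
          (partialFraction F t i).2 * q.den) := by
      simp only [partialFraction, addFraction, stageValue, hget, Option.getD_some, hq]
    have hqv : (ratNum q : ℝ) / q.den = q := by
      calc (ratNum q : ℝ) / q.den = ((ratNum q / q.den : ℚ) : ℝ) := by push_cast; rfl
        _ = q := by rw [ratNum_div_den (hF _ _)]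
    have h1 : ((partialFraction F t i).2 : ℝ) ≠ 0 := by exact_mod_cast hpos.ne'
    have h2 : (q.den : ℝ) ≠ 0 := by exact_mod_cast q.den_pos.ne'
    rw [hstep]
    refine ⟨Nat.mul_pos hpos q.den_pos, ?_⟩
    rw [List.take_add_one, hget, List.map_append, List.sum_append, ← heq]
    simp only [Option.toList_some, List.map_cons, List.map_nil, List.sum_cons, List.sum_nil,
      ← hq, ← hqv]
    push_cast
    field_simp
    ring

theorem computable_omegaFraction {F : List Bool → ℕ → ℚ}
    (hF : Computable fun p : List Bool × ℕ => F p.1 p.2) : Computable (omegaFraction F) := by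
  have hstep : Computable₂ fun (t : ℕ) (p : ℕ × ℕ × ℕ) => addFraction (stageValue F t p.1) p.2 :=
    computable_addFraction.comp
      ((computable_stageValue hF).comp Computable.fst (Computable.fst.comp Computable.snd))
      (Computable.snd.comp Computable.snd)
  exact Computable.nat_rec (Computable.list_length.comp primrec_stringsUpTo.to_comp)
    (Computable.const (0, 1)) hstep

theorem Omega_eq_sum (F : List Bool → ℕ → ℚ) (t : ℕ) :
    Omega F t = ∑ x ∈ (stringsUpTo t).toFinset, (F x t : ℝ) := by
  rw [Omega, tsum_eq_sum (s := (stringsUpTo t).toFinset)]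
  · refine Finset.sum_congr rfl fun x hx => if_pos ?_
    exact mem_stringsUpTo.1 (List.mem_toFinset.1 hx)
  · intro x hx
    exact if_neg fun h => hx (List.mem_toFinset.2 (mem_stringsUpTo.2 h))

theorem omegaFraction_snd_pos {F : List Bool → ℕ → ℚ} (hF : ∀ x s, 0 ≤ F x s) (t : ℕ) :
    0 < (omegaFraction F t).2 :=
  (partialFraction_spec hF t _ le_rfl).1

theorem Omega_eq_div {F : List Bool → ℕ → ℚ} (hF : ∀ x s, 0 ≤ F x s) (t : ℕ) :
    Omega F t = ((omegaFraction F t).1 : ℝ) / (omegaFraction F t).2 := by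
  rw [omegaFraction, (partialFraction_spec hF t _ le_rfl).2, List.take_length, Omega_eq_sum,
    List.sum_toFinset _ (nodup_stringsUpTo t)]

theorem Omega_nonneg {F : List Bool → ℕ → ℚ} (hF : ∀ x s, 0 ≤ F x s) (t : ℕ) : 0 ≤ Omega F t := by
  rw [Omega_eq_div hF]
  positivity

theorem Omega_mono {F : List Bool → ℕ → ℚ} (hF : ∀ x s, 0 ≤ F x s)
    (hmono : ∀ x, Monotone fun s => F x s) : Monotone (Omega F) := by
  intro s t hst
  rw [Omega_eq_sum, Omega_eq_sum]
  calc ∑ x ∈ (stringsUpTo s).toFinset, (F x s : ℝ)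
      ≤ ∑ x ∈ (stringsUpTo s).toFinset, (F x t : ℝ) :=
        Finset.sum_le_sum fun x _ => by exact_mod_cast hmono x hst
    _ ≤ ∑ x ∈ (stringsUpTo t).toFinset, (F x t : ℝ) := by
        refine Finset.sum_le_sum_of_subset_of_nonneg (fun x hx => ?_)
          fun x _ _ => by exact_mod_cast hF x t
        simp only [List.mem_toFinset, mem_stringsUpTo] at hx ⊢
        omega

theorem Omega_le_one {P : List Bool → ℝ≥0∞} {F : List Bool → ℕ → ℚ} (hP : IsSemimeasure P)
    (hF : IsApproxFromBelow P F) (t : ℕ) : Omega F t ≤ 1 := by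
  obtain ⟨-, hnn, -, hsup⟩ := hF
  rw [Omega_eq_sum, ← ENNReal.ofReal_le_one, ENNReal.ofReal_sum_of_nonneg fun x _ => by
    exact_mod_cast hnn x t]
  calc ∑ x ∈ (stringsUpTo t).toFinset, ENNReal.ofReal (F x t)
      ≤ ∑ x ∈ (stringsUpTo t).toFinset, P x :=
        Finset.sum_le_sum fun x _ => by
          rw [hsup x]
          exact le_iSup (fun s => qval (F x s)) t
    _ ≤ ∑' x, P x := ENNReal.sum_le_tsum _
    _ ≤ 1 := hP

/-- The integer part of `2^k Ω_t`. -/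
def omegaFloor (F : List Bool → ℕ → ℚ) (t k : ℕ) : ℕ :=
  2 ^ k * (omegaFraction F t).1 / (omegaFraction F t).2

theorem omegaFloor_eq_floor {F : List Bool → ℕ → ℚ} (hF : ∀ x s, 0 ≤ F x s) (t k : ℕ) :
    omegaFloor F t k = ⌊(2 : ℝ) ^ k * Omega F t⌋₊ := by
  rw [omegaFloor, Omega_eq_div hF, ← mul_div_assoc, ← Nat.floor_div_eq_div (K := ℝ)]
  push_cast
  rfl

theorem omegaFloor_ne_iff {F : List Bool → ℕ → ℚ} (hF : ∀ x s, 0 ≤ F x s) (s t k : ℕ) :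
    omegaFloor F s k ≠ omegaFloor F t k ↔
      ⌊(2 : ℝ) ^ k * Omega F s⌋ ≠ ⌊(2 : ℝ) ^ k * Omega F t⌋ := by
  have h : ∀ t, 0 ≤ (2 : ℝ) ^ k * Omega F t := fun t => mul_nonneg (by positivity) (Omega_nonneg hF t)
  rw [omegaFloor_eq_floor hF, omegaFloor_eq_floor hF, ← Int.natCast_floor_eq_floor (h s),
    ← Int.natCast_floor_eq_floor (h t), Ne, Ne, Nat.cast_inj]

theorem exists_floor_ne {x y : ℝ} (h : x ≠ y) : ∃ k : ℕ, ⌊(2 : ℝ) ^ k * x⌋ ≠ ⌊(2 : ℝ) ^ k * y⌋ := by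
  obtain ⟨k, hk⟩ := pow_unbounded_of_one_lt (|x - y|)⁻¹ (one_lt_two (α := ℝ))
  refine ⟨k, fun heq => ?_⟩
  have hpos : 0 < |x - y| := abs_pos.2 (sub_ne_zero.2 h)
  have h1 := Int.abs_sub_lt_one_of_floor_eq_floor heq
  rw [← mul_sub, abs_mul, abs_of_pos (by positivity : (0 : ℝ) < 2 ^ k)] at h1
  have h2 := mul_lt_mul_of_pos_right hk hpos
  rw [inv_mul_cancel₀ hpos.ne'] at h2
  linarith

theorem omegaFloor_mono {F : List Bool → ℕ → ℚ} (hF : ∀ x s, 0 ≤ F x s)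
    (hmono : ∀ x, Monotone fun s => F x s) (k : ℕ) : Monotone fun t => omegaFloor F t k := by
  intro s t hst
  simp only [omegaFloor_eq_floor hF]
  exact Nat.floor_mono (mul_le_mul_of_nonneg_left (Omega_mono hF hmono hst) (by positivity))

theorem omegaFloor_le {P : List Bool → ℝ≥0∞} {F : List Bool → ℕ → ℚ} (hP : IsSemimeasure P)
    (hF : IsApproxFromBelow P F) (t k : ℕ) : omegaFloor F t k ≤ 2 ^ k := by
  rw [omegaFloor_eq_floor hF.2.1]
  refine Nat.floor_le_of_le ?_
  push_cast
  exact mul_le_of_le_one_right (by positivity) (Omega_le_one hP hF t)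

theorem Omega_eq_iff {F : List Bool → ℕ → ℚ} (hF : ∀ x s, 0 ≤ F x s) (s t : ℕ) :
    Omega F s = Omega F t ↔
      (omegaFraction F s).1 * (omegaFraction F t).2 =
        (omegaFraction F t).1 * (omegaFraction F s).2 := by
  have h : ∀ t, ((omegaFraction F t).2 : ℝ) ≠ 0 := fun t => by
    exact_mod_cast (omegaFraction_snd_pos hF t).ne'
  rw [Omega_eq_div hF, Omega_eq_div hF, div_eq_div_iff (h s) (h t)]
  exact_mod_cast Iff.rfl

theorem tsum_increments_le {a : ℕ → ℕ} {b : ℕ} (hmono : Monotone a) (hb : ∀ t, a t ≤ b) :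
    ∑' t, ((a t - a (t - 1) : ℕ) : ℝ≥0∞) ≤ b := by
  have hsum : ∀ n, ∑ t ∈ Finset.range n, (a t - a (t - 1)) ≤ a (n - 1) := by
    intro n
    induction n with
    | zero => simp
    | succ n ih =>
      rw [Finset.sum_range_succ, Nat.add_sub_cancel]
      have := hmono (Nat.sub_le n 1)
      omega
  refine ENNReal.tsum_le_of_sum_range_le fun n => ?_
  exact_mod_cast (hsum n).trans (hb _)

theorem tsum_inv_two_pow_mul_le_one {A : ℕ → ℕ → ℕ} {D κ : ℕ → ℕ} {S : Set ℕ} [DecidablePred (· ∈ S)]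
    (hmono : ∀ k, Monotone fun t => A t k) (hA : ∀ t k, A t k ≤ 2 ^ k)
    (hD : ∑' k, (D k : ℝ≥0∞)⁻¹ ≤ 1)
    (hκ : ∀ t ∈ S, A t (κ t) ≠ A (t - 1) (κ t)) :
    ∑' t, (if t ∈ S then ((2 ^ κ t * D (κ t) : ℕ) : ℝ≥0∞)⁻¹ else 0) ≤ 1 := by
  calc ∑' t, (if t ∈ S then ((2 ^ κ t * D (κ t) : ℕ) : ℝ≥0∞)⁻¹ else 0)
      ≤ ∑' t, ∑' k, ((2 ^ k * D k : ℕ) : ℝ≥0∞)⁻¹ * ((A t k - A (t - 1) k : ℕ) : ℝ≥0∞) := by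
        refine ENNReal.tsum_le_tsum fun t => ?_
        split_ifs with ht
        · refine le_trans ?_ (ENNReal.le_tsum (κ t))
          refine le_mul_of_one_le_right (zero_le) ?_
          have h1 := hmono (κ t) (Nat.sub_le t 1)
          have h2 := hκ t ht
          have h3 : 1 ≤ A t (κ t) - A (t - 1) (κ t) := by
            simp only at h1
            omega
          exact_mod_cast h3
        · exact zero_le
    _ = ∑' k, ((2 ^ k * D k : ℕ) : ℝ≥0∞)⁻¹ * ∑' t, ((A t k - A (t - 1) k : ℕ) : ℝ≥0∞) := by
        rw [ENNReal.tsum_comm]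
        simp only [ENNReal.tsum_mul_left]
    _ ≤ ∑' k, (D k : ℝ≥0∞)⁻¹ := by
        refine ENNReal.tsum_le_tsum fun k => ?_
        calc ((2 ^ k * D k : ℕ) : ℝ≥0∞)⁻¹ * ∑' t, ((A t k - A (t - 1) k : ℕ) : ℝ≥0∞)
            ≤ ((2 ^ k * D k : ℕ) : ℝ≥0∞)⁻¹ * ((2 ^ k : ℕ) : ℝ≥0∞) := by
              gcongr
              exact tsum_increments_le (hmono k) fun t => hA t k
          _ = (D k : ℝ≥0∞)⁻¹ := by
              have h0 : ((2 ^ k : ℕ) : ℝ≥0∞) ≠ 0 := by simp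
              have htop : ((2 ^ k : ℕ) : ℝ≥0∞) ≠ ⊤ := ENNReal.natCast_ne_top _
              rw [Nat.cast_mul, ENNReal.mul_inv (Or.inl h0) (Or.inl htop), mul_right_comm,
                ENNReal.inv_mul_cancel h0 htop, one_mul]
    _ ≤ 1 := hD

theorem exists_forall_le_of_increment {A : ℕ → ℕ → ℕ} (hmono : ∀ k, Monotone fun t => A t k)
    (hA : ∀ t k, A t k ≤ 2 ^ k) (K : ℕ) :
    ∃ N, ∀ t, N ≤ t → ∀ k, A t k ≠ A (t - 1) k → K ≤ k := by
  have hstab : ∀ k, ∃ N, ∀ t, N ≤ t → A t k = A N k := by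
    intro k
    have hbdd : BddAbove (Set.range fun t => A t k) :=
      ⟨2 ^ k, by rintro _ ⟨t, rfl⟩; exact hA t k⟩
    obtain ⟨N, hN⟩ := Nat.sSup_mem (Set.range_nonempty _) hbdd
    refine ⟨N, fun t ht => le_antisymm ?_ (hmono k ht)⟩
    exact (le_csSup hbdd ⟨t, rfl⟩).trans hN.ge
  choose N hN using hstab
  refine ⟨(Finset.range K).sup N + 1, fun t ht k hne => ?_⟩
  by_contra hlt
  have hle : N k ≤ (Finset.range K).sup N := Finset.le_sup (Finset.mem_range.2 (not_le.1 hlt))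
  exact hne ((hN k t (by omega)).trans (hN k (t - 1) (by omega)).symm)

theorem summable_inv_succ_mul_sqrt_succ :
    Summable fun k : ℕ => (((k + 1) * (Nat.sqrt k + 1) : ℕ) : ℝ)⁻¹ := by
  have h : Summable fun k : ℕ => 1 / (((k + 1 : ℕ) : ℝ)) ^ (3 / 2 : ℝ) :=
    (summable_nat_add_iff 1).2 (Real.summable_one_div_nat_rpow.2 (by norm_num))
  refine h.of_nonneg_of_le (fun k => by positivity) fun k => ?_
  rw [← one_div]
  refine one_div_le_one_div_of_le (by positivity) ?_
  have hpos : (0 : ℝ) < ((k + 1 : ℕ) : ℝ) := by positivity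
  have hsplit : (((k + 1 : ℕ) : ℝ)) ^ (3 / 2 : ℝ) = ((k + 1 : ℕ) : ℝ) * √((k + 1 : ℕ) : ℝ) := by
    rw [Real.sqrt_eq_rpow, show (3 / 2 : ℝ) = 1 + 1 / 2 by norm_num, Real.rpow_add hpos,
      Real.rpow_one]
  rw [hsplit, Nat.cast_mul]
  refine mul_le_mul_of_nonneg_left (Real.sqrt_le_iff.2 ⟨by positivity, ?_⟩) hpos.le
  have hlt : k + 1 ≤ (Nat.sqrt k + 1) ^ 2 := by
    rw [pow_two]
    exact Nat.succ_le_of_lt (Nat.lt_succ_sqrt k)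
  exact_mod_cast hlt

theorem exists_tsum_inv_le_one :
    ∃ C : ℕ, 0 < C ∧ ∑' k : ℕ, ((C * ((k + 1) * (Nat.sqrt k + 1)) : ℕ) : ℝ≥0∞)⁻¹ ≤ 1 := by
  obtain ⟨C, hC⟩ := exists_nat_gt (∑' k : ℕ, (((k + 1) * (Nat.sqrt k + 1) : ℕ) : ℝ)⁻¹)
  have hCpos : (0 : ℝ) < C := (tsum_nonneg fun k => by positivity).trans_lt hC
  refine ⟨C, by exact_mod_cast hCpos, ?_⟩
  have hterm : ∀ k : ℕ, ((C * ((k + 1) * (Nat.sqrt k + 1)) : ℕ) : ℝ≥0∞)⁻¹ =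
      ENNReal.ofReal ((C : ℝ)⁻¹ * (((k + 1) * (Nat.sqrt k + 1) : ℕ) : ℝ)⁻¹) := by
    intro k
    rw [← mul_inv, ← Nat.cast_mul, ENNReal.ofReal_inv_of_pos, ENNReal.ofReal_natCast]
    exact_mod_cast Nat.mul_pos (by exact_mod_cast hCpos) (by positivity)
  simp only [hterm]
  rw [← ENNReal.ofReal_tsum_of_nonneg (fun k => by positivity)
    (summable_inv_succ_mul_sqrt_succ.mul_left _), tsum_mul_left, ENNReal.ofReal_le_one,
    inv_mul_le_iff₀ hCpos, mul_one]
  exact hC.le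

theorem exists_forall_mul_lt_sq (c : ℝ) (hc : 0 ≤ c) :
    ∃ K : ℕ, 0 < K ∧ ∀ k, K ≤ k → c * (((k + 1) * (Nat.sqrt k + 1) : ℕ) : ℝ) < (k : ℝ) ^ 2 := by
  obtain ⟨B, hB⟩ := exists_nat_gt (4 * c)
  refine ⟨(B + 1) * (B + 1), by positivity, fun k hk => ?_⟩
  have hr : B + 1 ≤ Nat.sqrt k := Nat.le_sqrt.2 hk
  have hrk : Nat.sqrt k * Nat.sqrt k ≤ k := Nat.sqrt_le k
  set r := Nat.sqrt k
  have hk1 : 1 ≤ k := le_trans (by nlinarith) hk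
  have h1 : (k + 1) * (r + 1) ≤ 4 * (k * r) := by nlinarith
  have h1' : (((k + 1) * (r + 1) : ℕ) : ℝ) ≤ 4 * (k * r) := by exact_mod_cast h1
  have hr' : (B : ℝ) + 1 ≤ r := by exact_mod_cast hr
  have hrk' : (r : ℝ) * r ≤ k := by exact_mod_cast hrk
  have hk' : (1 : ℝ) ≤ k := by exact_mod_cast hk1
  have hrpos : (0 : ℝ) < r := by positivity
  calc c * (((k + 1) * (r + 1) : ℕ) : ℝ) ≤ c * (4 * (k * r)) := by gcongr
    _ = (4 * c) * (k * r) := by ring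
    _ < r * (k * r) := by
        refine mul_lt_mul_of_pos_right (by linarith) (by positivity)
    _ = k * (r * r) := by ring
    _ ≤ k * k := by gcongr
    _ = (k : ℝ) ^ 2 := by ring

theorem zeros_injective : Function.Injective zeros := fun s t h => by
  simpa [zeros] using congrArg List.length h

theorem primrec_zeros : Primrec zeros := by
  refine (Primrec.nat_rec₁ (f := fun _ l => false :: l) [] ?_).of_eq fun n => ?_
  · exact Primrec.list_cons.comp (Primrec.const false) Primrec.snd
  · induction n with
    | zero => rfl
    | succ n ih => simp only [zeros, List.replicate_succ] at ih ⊢; rw [← ih]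

theorem qval_natCast_inv (n : ℕ) :
    qval ((n : ℚ)⁻¹) = if n = 0 then 0 else (n : ℝ≥0∞)⁻¹ := by
  split_ifs with h
  · simp [h, qval]
  · rw [qval, Rat.cast_inv, Rat.cast_natCast, ENNReal.ofReal_inv_of_pos (by positivity),
      ENNReal.ofReal_natCast]

/-- A computable sequence of unit fractions (with `0⁻¹ = 0`) is, up to a constant, below a
universal semimeasure on the strings of zeros. -/
theorem IsUniversalSemimeasure.exists_natCast_inv_le {m : List Bool → ℝ≥0∞}
    (hm : IsUniversalSemimeasure m) {n : ℕ → ℕ} (hn : Computable n)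
    (hsum : ∑' t, qval ((n t : ℚ)⁻¹) ≤ 1) :
    ∃ c : ℝ≥0, 0 < c ∧ ∀ t, qval ((n t : ℚ)⁻¹) ≤ c * m (zeros t) := by
  set g : List Bool → ℚ := fun x => (((if x = zeros x.length then n x.length else 0 : ℕ) : ℚ))⁻¹
    with hg
  have hlen : ∀ t, (zeros t).length = t := fun t => List.length_replicate
  have hgz : ∀ t, g (zeros t) = (n t : ℚ)⁻¹ := fun t => by simp [hg, hlen]
  have hcomp : Computable g := by
    refine computable_natCast_inv.comp ((Computable.cond
      (c := fun x : List Bool => decide (x = zeros x.length)) ?_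
      (hn.comp Computable.list_length) (Computable.const 0)).of_eq fun x => ?_)
    · exact (Primrec.eq.comp Primrec.id (primrec_zeros.comp Primrec.list_length)).decide.to_comp
    · by_cases hx : x = zeros x.length
      · rw [if_pos hx, decide_eq_true hx, cond_true]
      · rw [if_neg hx, decide_eq_false hx, cond_false]
  have hP : IsSemimeasure fun x => qval (g x) := by
    rw [IsSemimeasure, ← zeros_injective.tsum_eq]
    · simpa only [hgz] using hsum
    · intro x hx
      by_contra hne
      refine hx ?_
      have : x ≠ zeros x.length := fun h => hne ⟨_, h.symm⟩
      simp [hg, this, qval]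
  have hlsc : LowerSemicomputable fun x => qval (g x) :=
    ⟨fun x _ => g x, hcomp.comp Computable.fst, fun x _ => inv_nonneg.2 (Nat.cast_nonneg _),
      fun x => monotone_const, fun x => (ciSup_const).symm⟩
  obtain ⟨c, hc, hle⟩ := hm.2.2 _ hP hlsc
  exact ⟨c, hc, fun t => by simpa only [hgz] using hle (zeros t)⟩

theorem two_zpow_neg_div_sq {k : ℕ} (hk : 0 < k) :
    (2 : ℝ≥0∞) ^ (-(k : ℤ)) / (k : ℝ≥0∞) ^ 2 = ENNReal.ofReal ((2 ^ k * k ^ 2 : ℕ) : ℝ)⁻¹ := by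
  rw [ENNReal.ofReal_inv_of_pos (by positivity), ENNReal.ofReal_natCast, Nat.cast_mul,
    ENNReal.mul_inv (by simp) (by simp), div_eq_mul_inv, ENNReal.zpow_neg, zpow_natCast]
  push_cast
  rfl

theorem computable_two_pow : Computable fun n : ℕ => 2 ^ n := by
  have h : Primrec fun n : ℕ => 2 ^ n := by
    refine (Primrec.nat_rec₁ (f := fun _ r => r * 2) 1
      (Primrec.nat_mul.comp Primrec.snd (Primrec.const 2))).of_eq fun n => ?_
    induction n with
    | zero => rfl
    | succ n ih => rw [pow_succ, ← ih]
  exact h.to_comp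

theorem computable_omegaFloor {F : List Bool → ℕ → ℚ}
    (hF : Computable fun p : List Bool × ℕ => F p.1 p.2) : Computable₂ (omegaFloor F) := by
  have hΩ : Computable fun a : ℕ × ℕ => omegaFraction F a.1 :=
    (computable_omegaFraction hF).comp Computable.fst
  have hpow : Computable fun a : ℕ × ℕ => 2 ^ a.2 := computable_two_pow.comp Computable.snd
  have hnum : Computable fun a : ℕ × ℕ => 2 ^ a.2 * (omegaFraction F a.1).1 :=
    Primrec.nat_mul.to_comp.comp hpow (Computable.fst.comp hΩ)
  exact Primrec.nat_div.to_comp.comp hnum (Computable.snd.comp hΩ)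

/-- Whether `Ω_t = Ω_{t-1}`, as a Boolean. -/
def omegaUnchanged (F : List Bool → ℕ → ℚ) (t : ℕ) : Bool :=
  decide ((omegaFraction F t).1 * (omegaFraction F (t - 1)).2 =
    (omegaFraction F (t - 1)).1 * (omegaFraction F t).2)

theorem omegaUnchanged_iff {F : List Bool → ℕ → ℚ} (hF : ∀ x s, 0 ≤ F x s) (t : ℕ) :
    omegaUnchanged F t = true ↔ Omega F t = Omega F (t - 1) := by
  rw [omegaUnchanged, decide_eq_true_iff, Omega_eq_iff hF]

theorem computable_omegaUnchanged {F : List Bool → ℕ → ℚ}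
    (hF : Computable fun p : List Bool × ℕ => F p.1 p.2) : Computable (omegaUnchanged F) := by
  have h1 := computable_omegaFraction hF
  have h2 : Computable fun t => omegaFraction F (t - 1) := h1.comp Computable.pred
  have h3 : Computable fun t => (omegaFraction F t).1 * (omegaFraction F (t - 1)).2 :=
    Primrec.nat_mul.to_comp.comp (Computable.fst.comp h1) (Computable.snd.comp h2)
  have h4 : Computable fun t => (omegaFraction F (t - 1)).1 * (omegaFraction F t).2 :=
    Primrec.nat_mul.to_comp.comp (Computable.fst.comp h2) (Computable.snd.comp h1)
  exact Primrec.eq.decide.to_comp.comp h3 h4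

/-- The position of the leftmost binary digit in which `Ω_t` and `Ω_{t-1}` differ is computable. -/
theorem exists_computable_leftmost_digit {F : List Bool → ℕ → ℚ}
    (hF : Computable fun p : List Bool × ℕ => F p.1 p.2) (hnn : ∀ x s, 0 ≤ F x s) :
    ∃ κ : ℕ → ℕ, Computable κ ∧ ∀ t, Omega F t ≠ Omega F (t - 1) →
      omegaFloor F t (κ t) ≠ omegaFloor F (t - 1) (κ t) ∧
        ∀ k, omegaFloor F t k ≠ omegaFloor F (t - 1) k → κ t ≤ k := by
  have hfl1 : Computable fun a : ℕ × ℕ => omegaFloor F a.1 a.2 :=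
    (computable_omegaFloor hF).comp Computable.fst Computable.snd
  have hfl2 : Computable fun a : ℕ × ℕ => omegaFloor F (a.1 - 1) a.2 :=
    (computable_omegaFloor hF).comp (Computable.pred.comp Computable.fst) Computable.snd
  have hne : Computable fun a : ℕ × ℕ =>
      !decide (omegaFloor F a.1 a.2 = omegaFloor F (a.1 - 1) a.2) :=
    Primrec.not.to_comp.comp (Primrec.eq.decide.to_comp.comp hfl1 hfl2)
  have hun : Computable fun a : ℕ × ℕ => omegaUnchanged F a.1 :=
    (computable_omegaUnchanged hF).comp Computable.fst
  have hp : Computable₂ fun t k : ℕ => omegaUnchanged F t ||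
      !decide (omegaFloor F t k = omegaFloor F (t - 1) k) :=
    Primrec.or.to_comp.comp hun hne
  have hiff : ∀ t k, Omega F t ≠ Omega F (t - 1) → ((omegaUnchanged F t ||
      !decide (omegaFloor F t k = omegaFloor F (t - 1) k)) = true ↔
        omegaFloor F t k ≠ omegaFloor F (t - 1) k) := by
    intro t k h
    simp [omegaUnchanged_iff hnn, h]
  have hex : ∀ t, ∃ k, (omegaUnchanged F t ||
      !decide (omegaFloor F t k = omegaFloor F (t - 1) k)) = true := by
    intro t
    by_cases h : Omega F t = Omega F (t - 1)
    · exact ⟨0, by rw [(omegaUnchanged_iff hnn t).2 h, Bool.true_or]⟩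
    · obtain ⟨k, hk⟩ := exists_floor_ne h
      exact ⟨k, (hiff t k h).2 ((omegaFloor_ne_iff hnn _ _ _).2 hk)⟩
  refine ⟨_, Computable.natFind hp hex, fun t ht => ⟨(hiff t _ ht).1 (Nat.find_spec (hex t)),
    fun k hk => Nat.find_min' (hex t) ((hiff t k ht).2 hk)⟩⟩

theorem computable_nat_sqrt : Computable Nat.sqrt := by
  have hp : Computable₂ fun n r : ℕ => decide (n < (r + 1) * (r + 1)) :=
    (Primrec.nat_lt.decide.comp Primrec.fst (Primrec.nat_mul.comp
      (Primrec.succ.comp Primrec.snd) (Primrec.succ.comp Primrec.snd))).to_comp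
  have hex : ∀ n : ℕ, ∃ r, decide (n < (r + 1) * (r + 1)) = true := fun n =>
    ⟨Nat.sqrt n, decide_eq_true (Nat.lt_succ_sqrt n)⟩
  refine (Computable.natFind hp hex).of_eq fun n => le_antisymm ?_ ?_
  · exact Nat.find_min' (hex n) (decide_eq_true (Nat.lt_succ_sqrt n))
  · have h := decide_eq_true_iff.1 (Nat.find_spec (hex n))
    exact Nat.le_of_lt_succ (Nat.sqrt_lt.2 h)

/-- Search for a stage at which a computable approximation exceeds a computable threshold
`1 / B t`, at every `t` outside a decidable set. -/
theorem exists_computable_stage {F : List Bool → ℕ → ℚ}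
    (hF : Computable fun p : List Bool × ℕ => F p.1 p.2) (hnn : ∀ x s, 0 ≤ F x s)
    {B : ℕ → ℕ} (hB : Computable B) (hBpos : ∀ t, 0 < B t) {skip : ℕ → Bool}
    (hskip : Computable skip)
    (hex : ∀ t, skip t = false → ∃ s, ((B t : ℕ) : ℝ)⁻¹ ≤ F (zeros t) s) :
    ∃ f : ℕ → ℕ, Computable f ∧
      ∀ t, skip t = false → ((B t : ℕ) : ℝ)⁻¹ ≤ F (zeros t) (f t) := by
  have hq : Computable fun a : ℕ × ℕ => F (zeros a.1) a.2 := by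
    have hpair : Computable fun a : ℕ × ℕ => (zeros a.1, a.2) :=
      (primrec_zeros.to_comp.comp Computable.fst).pair Computable.snd
    exact (hF.comp hpair).of_eq fun _ => rfl
  have hn : Computable fun a : ℕ × ℕ => ratNum (F (zeros a.1) a.2) := computable_ratNum.comp hq
  have hd : Computable fun a : ℕ × ℕ => (F (zeros a.1) a.2).den := computable_ratDen.comp hq
  have hBa : Computable fun a : ℕ × ℕ => B a.1 := hB.comp Computable.fst
  have hprod : Computable fun a : ℕ × ℕ => ratNum (F (zeros a.1) a.2) * B a.1 :=
    Primrec.nat_mul.to_comp.comp hn hBa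
  have hle : Computable fun a : ℕ × ℕ =>
      decide ((F (zeros a.1) a.2).den ≤ ratNum (F (zeros a.1) a.2) * B a.1) :=
    Primrec.nat_le.decide.to_comp.comp hd hprod
  have hsk : Computable fun a : ℕ × ℕ => skip a.1 := hskip.comp Computable.fst
  have hp : Computable₂ fun t s : ℕ =>
      skip t || decide ((F (zeros t) s).den ≤ ratNum (F (zeros t) s) * B t) :=
    Primrec.or.to_comp.comp hsk hle
  have hiff : ∀ t s, (F (zeros t) s).den ≤ ratNum (F (zeros t) s) * B t ↔
      ((B t : ℕ) : ℝ)⁻¹ ≤ F (zeros t) s := by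
    intro t s
    have hval : (F (zeros t) s : ℝ) = ratNum (F (zeros t) s) / (F (zeros t) s).den := by
      conv_lhs => rw [← ratNum_div_den (hnn (zeros t) s)]
      push_cast
      rfl
    have hBt : (0 : ℝ) < B t := by exact_mod_cast hBpos t
    have hden : (0 : ℝ) < (F (zeros t) s).den := by exact_mod_cast (F (zeros t) s).den_pos
    rw [hval, inv_eq_one_div, div_le_div_iff₀ hBt hden, one_mul]
    exact_mod_cast Iff.rfl
  have hex' : ∀ t, ∃ s,
      (skip t || decide ((F (zeros t) s).den ≤ ratNum (F (zeros t) s) * B t)) = true := by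
    intro t
    cases h : skip t with
    | true => exact ⟨0, Bool.true_or _⟩
    | false =>
      obtain ⟨s, hs⟩ := hex t h
      exact ⟨s, by rw [Bool.false_or, decide_eq_true_iff]; exact (hiff t s).2 hs⟩
  refine ⟨_, Computable.natFind hp hex', fun t ht => ?_⟩
  have h := Nat.find_spec (hex' t)
  rw [Bool.or_eq_true, decide_eq_true_iff] at h
  exact (hiff t _).1 (h.resolve_left (by simp [ht]))

/-- The technical part of the proof of Lemma 1: there is a computable `f` such that, for all
sufficiently large `t` with `Ω_t ≠ Ω_{t-1}`, if `k` is the position of the leftmost binary digit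
where `Ω_t` and `Ω_{t-1}` differ, then `m_{f(t)}(t) ≥ 2^{-k}/k²`. -/
theorem approx_large_at_change_times
    (m : List Bool → ℝ≥0∞) (mt : List Bool → ℕ → ℚ)
    (hm : IsUniversalSemimeasure m) (hmt : IsApproxFromBelow m mt) :
    ∃ f : ℕ → ℕ, Computable f ∧ ∃ N : ℕ, ∀ t : ℕ, N ≤ t →
      Omega mt t ≠ Omega mt (t - 1) →
      ∀ k : ℕ,
        (⌊(2 : ℝ) ^ k * Omega mt t⌋ ≠ ⌊(2 : ℝ) ^ k * Omega mt (t - 1)⌋ ∧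
          ∀ j < k, ⌊(2 : ℝ) ^ j * Omega mt t⌋ = ⌊(2 : ℝ) ^ j * Omega mt (t - 1)⌋) →
        (2 : ℝ≥0∞) ^ (-(k : ℤ)) / (k : ℝ≥0∞) ^ 2 ≤ qval (mt (zeros t) (f t)) := by
  classical
  obtain ⟨hcomp, hnn, hmono, hsup⟩ := hmt
  obtain ⟨κ, hκ, hκspec⟩ := exists_computable_leftmost_digit hcomp hnn
  obtain ⟨C, hC, hD⟩ := exists_tsum_inv_le_one
  have hDcomp : Computable fun k : ℕ => C * ((k + 1) * (Nat.sqrt k + 1)) :=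
    Primrec.nat_mul.to_comp.comp (Computable.const C)
      (Primrec.nat_mul.to_comp.comp Computable.succ (Computable.succ.comp computable_nat_sqrt))
  set D : ℕ → ℕ := fun k => C * ((k + 1) * (Nat.sqrt k + 1))
  have hDpos : ∀ k, 0 < D k := fun k => Nat.mul_pos hC (by positivity)
  have hnpos : ∀ t, 0 < 2 ^ κ t * D (κ t) := fun t => Nat.mul_pos (by positivity) (hDpos _)
  have hcomp_pow : Computable fun t => 2 ^ κ t := computable_two_pow.comp hκ
  -- the weights `2^{-k_t} / D(k_t)` at the change times
  set n : ℕ → ℕ := fun t => bif omegaUnchanged mt t then 0 else 2 ^ κ t * D (κ t) with hn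
  have hncomp : Computable n :=
    Computable.cond (computable_omegaUnchanged hcomp) (Computable.const 0)
      (Primrec.nat_mul.to_comp.comp hcomp_pow (hDcomp.comp hκ))
  have hnchange : ∀ t, Omega mt t ≠ Omega mt (t - 1) → n t = 2 ^ κ t * D (κ t) := by
    intro t ht
    have hu : omegaUnchanged mt t = false := by
      rwa [← Bool.not_eq_true, omegaUnchanged_iff hnn]
    simp [hn, hu]
  have hfloor_mono := omegaFloor_mono hnn hmono
  have hfloor_le := omegaFloor_le hm.1 ⟨hcomp, hnn, hmono, hsup⟩
  have hsum : ∑' t, qval ((n t : ℚ)⁻¹) ≤ 1 := by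
    refine le_trans (ENNReal.tsum_le_tsum fun t => ?_)
      (tsum_inv_two_pow_mul_le_one (S := {t | Omega mt t ≠ Omega mt (t - 1)}) (κ := κ)
        hfloor_mono hfloor_le hD fun t ht => (hκspec t ht).1)
    by_cases ht : Omega mt t = Omega mt (t - 1)
    · have hu := (omegaUnchanged_iff hnn t).2 ht
      simp [hn, hu, qval]
    · rw [hnchange t ht, qval_natCast_inv, if_neg (hnpos t).ne']
      exact (if_pos (c := t ∈ {t | Omega mt t ≠ Omega mt (t - 1)}) ht).ge
  obtain ⟨c, hc, hcm⟩ := hm.exists_natCast_inv_le hncomp hsum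
  obtain ⟨K, hKpos, hK⟩ := exists_forall_mul_lt_sq (c * C) (by positivity)
  obtain ⟨N, hN⟩ := exists_forall_le_of_increment hfloor_mono hfloor_le K
  have hlarge : ∀ t, N ≤ t → Omega mt t ≠ Omega mt (t - 1) → K ≤ κ t := fun t ht hne =>
    hN t ht _ (hκspec t hne).1
  -- the threshold is `1 / B t`, made positive where `k_t = 0`
  set B : ℕ → ℕ := fun t => 2 ^ κ t * (κ t * κ t) + (1 - κ t) with hBdef
  have hBpos : ∀ t, 0 < B t := by
    intro t
    rcases Nat.eq_zero_or_pos (κ t) with h | h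
    · simp [hBdef, h]
    · simp only [hBdef]
      positivity
  have hBcomp : Computable B :=
    Primrec.nat_add.to_comp.comp
      (Primrec.nat_mul.to_comp.comp hcomp_pow (Primrec.nat_mul.to_comp.comp hκ hκ))
      (Primrec.nat_sub.to_comp.comp (Computable.const 1) hκ)
  have hBeq : ∀ t, 0 < κ t → B t = 2 ^ κ t * κ t ^ 2 := by
    intro t ht
    simp only [hBdef, Nat.sub_eq_zero_of_le ht, pow_two, add_zero]
  have hskip : Computable fun t => decide (t < N) || omegaUnchanged mt t :=
    Primrec.or.to_comp.comp
      (Primrec.nat_lt.decide.to_comp.comp Computable.id (Computable.const N))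
      (computable_omegaUnchanged hcomp)
  have hskip_iff : ∀ t, (decide (t < N) || omegaUnchanged mt t) = false ↔
      N ≤ t ∧ Omega mt t ≠ Omega mt (t - 1) := by
    intro t
    rw [Bool.or_eq_false_iff, decide_eq_false_iff_not, not_lt, ← Bool.not_eq_true,
      omegaUnchanged_iff hnn]
  obtain ⟨f, hf, hfB⟩ := exists_computable_stage hcomp hnn hBcomp hBpos hskip fun t ht => by
    obtain ⟨hNt, hne⟩ := (hskip_iff t).1 ht
    have hKt := hlarge t hNt hne
    by_contra! hlt
    have hm_le : m (zeros t) ≤ ENNReal.ofReal (B t : ℝ)⁻¹ := by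
      rw [hsup]
      exact iSup_le fun s => ENNReal.ofReal_le_ofReal (hlt s).le
    have h1 : ENNReal.ofReal ((2 ^ κ t * D (κ t) : ℕ) : ℝ)⁻¹ ≤
        ENNReal.ofReal (c * (B t : ℝ)⁻¹) := by
      calc ENNReal.ofReal ((2 ^ κ t * D (κ t) : ℕ) : ℝ)⁻¹ = qval ((n t : ℚ)⁻¹) := by
            rw [hnchange t hne, qval, Rat.cast_inv, Rat.cast_natCast]
        _ ≤ c * m (zeros t) := hcm t
        _ ≤ c * ENNReal.ofReal (B t : ℝ)⁻¹ := by gcongr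
        _ = ENNReal.ofReal (c * (B t : ℝ)⁻¹) := by
            rw [ENNReal.ofReal_mul c.coe_nonneg, ENNReal.ofReal_coe_nnreal]
    have hBr : (0 : ℝ) < B t := by exact_mod_cast hBpos t
    have hnr : (0 : ℝ) < ((2 ^ κ t * D (κ t) : ℕ) : ℝ) := by exact_mod_cast hnpos t
    rw [ENNReal.ofReal_le_ofReal_iff (by positivity), ← div_eq_mul_inv, inv_eq_one_div,
      div_le_div_iff₀ hnr hBr, one_mul, hBeq t (by omega)] at h1
    have h2 := hK (κ t) hKt
    have h3 : (0 : ℝ) < 2 ^ κ t := by positivity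
    simp only [D] at h1
    push_cast at h1 h2
    have h4 := mul_lt_mul_of_pos_left h2 h3
    linarith
  refine ⟨f, hf, N, fun t ht hne k hk => ?_⟩
  obtain ⟨hk1, hk2⟩ := hk
  have hspec := hκspec t hne
  have hkκ : κ t = k := by
    refine le_antisymm (hspec.2 k ((omegaFloor_ne_iff hnn _ _ _).2 hk1)) (not_lt.1 fun hlt => ?_)
    exact (omegaFloor_ne_iff hnn _ _ _).1 hspec.1 (hk2 _ hlt)
  have hkpos : 0 < κ t := hKpos.trans_le (hlarge t ht hne)
  have hfinal := hfB t ((hskip_iff t).2 ⟨ht, hne⟩)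
  rw [hBeq t hkpos, hkκ] at hfinal
  rw [two_zpow_neg_div_sq (hkκ ▸ hkpos)]
  exact ENNReal.ofReal_le_ofReal hfinal
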